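/- Define φ₀ : (0,∞) → ℝ by φ₀(c) = liminf_{n→∞} n^{-3/2}·log P_{c/√n}( X = 0 ) (using the edge probability min(1, c/√n)). Then there exists c* ∈ [e^{-1/2}, 4.342) such that φ₀ is not real-analytic at c*. -/

import Mathlib

open Filter
open scoped BigOperators symmDiff Classical

noncomputable section

/-- Number of edges of a labeled simple graph on `Fin n`. -/
def edgeCount {n : ℕ} (G : SimpleGraph (Fin n)) : ℕ := Nat.card G.edgeSet

/-- Number of triangles of a labeled simple graph on `Fin n`. -/
def triCount {n : ℕ} (G : SimpleGraph (Fin n)) : ℕ :=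
  Nat.card {s : Finset (Fin n) // G.IsNClique 3 s}

/-- Probability of the event `A` under the Erdős–Rényi random graph `G(n,p)`. -/
def erProb (n : ℕ) (p : ℝ) (A : Set (SimpleGraph (Fin n))) : ℝ :=
  ∑ G : SimpleGraph (Fin n),
    if G ∈ A then p ^ edgeCount G * (1 - p) ^ (n.choose 2 - edgeCount G) else 0

/-- Conditional probability `P_p(A | B)` for `G(n,p)`. -/
def erCondProb (n : ℕ) (p : ℝ) (A B : Set (SimpleGraph (Fin n))) : ℝ :=
  erProb n p (A ∩ B) / erProb n p B

/-- Probability of the event `A` under the uniform random graph `G(n,m)`. -/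
def gnmProb (n m : ℕ) (A : Set (SimpleGraph (Fin n))) : ℝ :=
  (Nat.card {G : SimpleGraph (Fin n) // edgeCount G = m ∧ G ∈ A} : ℝ) /
    ((n.choose 2).choose m : ℝ)

/-- Expected number of triangles of `G(n,m)`. -/
def gnmExpTri (n m : ℕ) : ℝ :=
  (∑ G : SimpleGraph (Fin n), if edgeCount G = m then (triCount G : ℝ) else 0) /
    ((n.choose 2).choose m : ℝ)

/-- Gibbs weight `λ^{|G|} (1-ζ)^{X(G)}`. -/
def gibbsWeight {n : ℕ} (lam zeta : ℝ) (G : SimpleGraph (Fin n)) : ℝ :=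
  lam ^ edgeCount G * (1 - zeta) ^ triCount G

/-- The partition function `Z(λ,ζ)`. -/
def Zfun (n : ℕ) (lam zeta : ℝ) : ℝ := ∑ G : SimpleGraph (Fin n), gibbsWeight lam zeta G

/-- Probability of the event `A` under the Gibbs measure `μ_{λ,ζ}`. -/
def gibbsProb (n : ℕ) (lam zeta : ℝ) (A : Set (SimpleGraph (Fin n))) : ℝ :=
  (∑ G : SimpleGraph (Fin n), if G ∈ A then gibbsWeight lam zeta G else 0) / Zfun n lam zeta

/-- Expectation of `f` under the Gibbs measure `μ_{λ,ζ}`. -/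
def gibbsExp (n : ℕ) (lam zeta : ℝ) (f : SimpleGraph (Fin n) → ℝ) : ℝ :=
  (∑ G : SimpleGraph (Fin n), f G * gibbsWeight lam zeta G) / Zfun n lam zeta

/-- Number of edges of `H` with both endpoints in `S`. -/
def edgesIn {V : Type*} (H : SimpleGraph V) (S : Finset V) : ℕ :=
  Nat.card {e : Sym2 V // e ∈ H.edgeSet ∧ ∀ v ∈ e, v ∈ S}

/-- Weight `λ^{|S|} (1-ζ)^{|E(S)|}` of the measure `ν_{H,λ,ζ}`. -/
def nuWeight {V : Type*} (H : SimpleGraph V) (lam zeta : ℝ) (S : Finset V) : ℝ :=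
  lam ^ S.card * (1 - zeta) ^ edgesIn H S

/-- The partition function `Ξ_H(λ,ζ)`. -/
def XiFun {V : Type*} [Fintype V] (H : SimpleGraph V) (lam zeta : ℝ) : ℝ :=
  ∑ S : Finset V, nuWeight H lam zeta S

/-- The probability of `S` under `ν_{H,λ,ζ}`. -/
def nuProb {V : Type*} [Fintype V] (H : SimpleGraph V) (lam zeta : ℝ) (S : Finset V) : ℝ :=
  nuWeight H lam zeta S / XiFun H lam zeta

/-- `W` is the Lambert-W function on `[0,∞)`: for `x ≥ 0`, `W x` is the unique `w ≥ 0`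
with `w·e^w = x`. -/
def IsLambertW (W : ℝ → ℝ) : Prop :=
  ∀ x : ℝ, 0 ≤ x → (0 ≤ W x ∧ W x * Real.exp (W x) = x ∧
    ∀ w : ℝ, 0 ≤ w → w * Real.exp w = x → w = W x)

/-- `η* = (W(2/e)/(2/e))^{3/2}`. -/
def etaStar (W : ℝ → ℝ) : ℝ := (W (2 / Real.exp 1) / (2 / Real.exp 1)) ^ ((3 : ℝ) / 2)

/-- The condition `c < c̄(η)` where `c̄(η) = 1/√(e(1−η/η*))` for `η < η*` and `+∞` otherwise. -/
def LtCbar (W : ℝ → ℝ) (c η : ℝ) : Prop :=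
  η < etaStar W → c < 1 / Real.sqrt (Real.exp 1 * (1 - η / etaStar W))

/-- The left-hand side of the equation defining `ζ(c,η)`, interpreted as `1` at `ζ = 0`. -/
def zetaLHS (W : ℝ → ℝ) (c zeta : ℝ) : ℝ :=
  (1 - zeta) * (if zeta = 0 then 1 else
    (W (2 * zeta * c ^ 2) / (2 * zeta * c ^ 2)) ^ ((3 : ℝ) / 2))

section HypergraphGas

variable {E : Type*} [DecidableEq E] {S : Finset E} {T H : Finset (Finset E)}

/-- `H` is a linear `3`-uniform hypergraph, regular of degree `D`. -/
structure IsLinearTriples (H : Finset (Finset E)) (D : ℕ) : Prop where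
  card_eq : ∀ t ∈ H, t.card = 3
  eq_of_mem : ∀ t ∈ H, ∀ t' ∈ H, ∀ a b, a ≠ b → a ∈ t → b ∈ t → a ∈ t' → b ∈ t' → t = t'
  degree : ∀ f, (H.filter (f ∈ ·)).card = D

/-- `T` is a subfamily of `H` all of whose missing members meet `S`, where `|S| ≤ k`. -/
def NearFull (H : Finset (Finset E)) (k : ℕ) (S : Finset E) (T : Finset (Finset E)) : Prop :=
  S.card ≤ k ∧ T ⊆ H ∧ ∀ h ∈ H, h ∉ T → ¬ Disjoint h S

lemma NearFull.insert {k : ℕ} (h : NearFull H k S T) (a : E) :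
    NearFull H (k + 1) (insert a S) T := by
  refine ⟨(Finset.card_insert_le _ _).trans (Nat.succ_le_succ h.1), h.2.1, fun t ht ht' hd => ?_⟩
  exact h.2.2 t ht ht' (hd.mono_right (Finset.subset_insert _ _))

lemma NearFull.insert_filter_union {k : ℕ} (h : NearFull H k S T) (f : E)
    {B : Finset (Finset E)} (hB : B ⊆ T) :
    NearFull H (k + 1) (Insert.insert f S) (T.filter (f ∉ ·) ∪ B) := by
  refine ⟨(Finset.card_insert_le _ _).trans (Nat.succ_le_succ h.1),
    Finset.union_subset ((Finset.filter_subset _ _).trans h.2.1) (hB.trans h.2.1),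
    fun t ht ht' hd => ?_⟩
  rw [Finset.disjoint_insert_right] at hd
  refine h.2.2 t ht (fun hT => ht' ?_) hd.2
  exact Finset.mem_union_left _ (Finset.mem_filter.2 ⟨hT, hd.1⟩)

lemma filter_notMem_union_filter_mem (f : E) :
    T.filter (f ∉ ·) ∪ T.filter (f ∈ ·) = T := by
  rw [Finset.union_comm]
  exact Finset.filter_union_filter_not_eq _ _

lemma exists_eq_triple {t : Finset E} (ht : t.card = 3) {f : E} (hf : f ∈ t) :
    ∃ a b, a ≠ f ∧ b ≠ f ∧ a ≠ b ∧ t = {f, a, b} := by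
  have h2 : (t.erase f).card = 2 := by rw [Finset.card_erase_of_mem hf, ht]
  obtain ⟨a, b, hab, h⟩ := Finset.card_eq_two.1 h2
  have ha : a ∈ t.erase f := by simp [h]
  have hb : b ∈ t.erase f := by simp [h]
  refine ⟨a, b, (Finset.mem_erase.1 ha).1, (Finset.mem_erase.1 hb).1, hab, ?_⟩
  rw [← h, Finset.insert_erase hf]

lemma IsLinearTriples.card_meeting_le {D : ℕ} (hH : IsLinearTriples H D) {f : E} (hf : f ∉ S) :
    (H.filter (fun t => f ∈ t ∧ ¬ Disjoint t S)).card ≤ S.card := by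
  have hsub : H.filter (fun t => f ∈ t ∧ ¬ Disjoint t S) ⊆
      S.biUnion fun s => H.filter (fun t => f ∈ t ∧ s ∈ t) := by
    intro t ht
    simp only [Finset.mem_filter, Finset.not_disjoint_iff, Finset.mem_biUnion] at ht ⊢
    obtain ⟨h1, h2, s, h3, h4⟩ := ht
    exact ⟨s, h4, h1, h2, h3⟩
  refine (Finset.card_le_card hsub).trans ?_
  refine (Finset.card_biUnion_le_card_mul S _ 1 fun s hs => ?_).trans (by simp)
  rw [Finset.card_le_one]
  intro t ht t' ht'
  simp only [Finset.mem_filter] at ht ht'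
  exact hH.eq_of_mem t ht.1 t' ht'.1 f s (fun h => hf (h ▸ hs)) ht.2.1 ht.2.2 ht'.2.1 ht'.2.2

lemma IsLinearTriples.card_blocking_le {D : ℕ} (hH : IsLinearTriples H D) (f : E) :
    (H.filter (fun t => f ∈ t ∧ Disjoint t S ∧
      ∃ h ∈ H, f ∉ h ∧ ¬ Disjoint h t ∧ h ⊆ S ∪ t)).card ≤ S.card ^ 2 := by
  have hsub : H.filter (fun t => f ∈ t ∧ Disjoint t S ∧
      ∃ h ∈ H, f ∉ h ∧ ¬ Disjoint h t ∧ h ⊆ S ∪ t) ⊆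
      (S ×ˢ S).biUnion fun s => H.filter (fun t => f ∈ t ∧ Disjoint t S ∧
        s.1 ≠ s.2 ∧ ∃ h ∈ H, ∃ a, a ≠ f ∧ a ∈ t ∧ h = {a, s.1, s.2}) := by
    intro t ht
    simp only [Finset.mem_filter, Finset.not_disjoint_iff, Finset.mem_biUnion] at ht ⊢
    obtain ⟨ht, hft, hd, h, hh, hfh, ⟨a, hah, hat⟩, hhs⟩ := ht
    obtain ⟨b, c, hba, hca, hbc, rfl⟩ := exists_eq_triple (hH.card_eq h hh) hah
    have hne : ({a, b, c} : Finset E) ≠ t := fun h => hfh (h ▸ hft)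
    have hbS : b ∈ S := by
      rcases Finset.mem_union.1 (hhs (show b ∈ _ by simp)) with h | h
      · exact h
      · exact absurd (hH.eq_of_mem _ hh _ ht a b hba.symm hah (by simp) hat h) hne
    have hcS : c ∈ S := by
      rcases Finset.mem_union.1 (hhs (show c ∈ _ by simp)) with h | h
      · exact h
      · exact absurd (hH.eq_of_mem _ hh _ ht a c hca.symm hah (by simp) hat h) hne
    exact ⟨(b, c), Finset.mem_product.2 ⟨hbS, hcS⟩, ht, hft, hd, hbc, _, hh, a,
      fun h => hfh (h ▸ hah), hat, rfl⟩
  refine (Finset.card_le_card hsub).trans ?_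
  refine (Finset.card_biUnion_le_card_mul _ _ 1 fun s hs => ?_).trans
    (by simp [Finset.card_product, pow_two])
  rw [Finset.card_le_one]
  intro t ht t' ht'
  rw [Finset.mem_filter] at ht ht'
  obtain ⟨ht, hft, hd, hs12, h, hh, a, haf, hat, rfl⟩ := ht
  obtain ⟨ht', hft', hd', -, h', hh', a', haf', hat', rfl⟩ := ht'
  rw [Finset.mem_product] at hs
  have heq := hH.eq_of_mem _ hh _ hh' s.1 s.2 hs12 (by simp) (by simp) (by simp) (by simp)
  have ha : a ∈ ({a', s.1, s.2} : Finset E) := heq ▸ (by simp)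
  have haa : a = a' := by
    simp only [Finset.mem_insert, Finset.mem_singleton] at ha
    rcases ha with h | h | h
    · exact h
    · exact absurd (h ▸ hs.1) (Finset.disjoint_left.1 hd hat)
    · exact absurd (h ▸ hs.2) (Finset.disjoint_left.1 hd hat)
  subst haa
  exact hH.eq_of_mem t ht t' ht' a f haf hat hft hat' hft'

variable [Fintype E] {lam : ℝ}

/-- The total weight `∑ lam ^ |G|` of the vertex sets `G ⊇ S` containing no member of `T`. -/
def gasZ (lam : ℝ) (S : Finset E) (T : Finset (Finset E)) : ℝ :=
  ∑ G : Finset E with S ⊆ G ∧ ∀ t ∈ T, ¬ t ⊆ G, lam ^ G.card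

lemma gasZ_nonneg (hl : 0 ≤ lam) : 0 ≤ gasZ lam S T :=
  Finset.sum_nonneg fun _ _ => by positivity

lemma gasZ_anti (hl : 0 ≤ lam) {S' : Finset E} (h : S ⊆ S') :
    gasZ lam S' T ≤ gasZ lam S T := by
  refine Finset.sum_le_sum_of_subset_of_nonneg ?_ fun _ _ _ => by positivity
  intro G hG
  simp only [Finset.mem_filter, Finset.mem_univ, true_and] at hG ⊢
  exact ⟨h.trans hG.1, hG.2⟩

lemma gasZ_insert_right (t : Finset E) :
    gasZ lam S (insert t T) = gasZ lam S T - gasZ lam (S ∪ t) T := by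
  rw [eq_sub_iff_add_eq]
  unfold gasZ
  rw [← Finset.sum_union]
  · congr 1
    ext G
    simp only [Finset.mem_union, Finset.mem_filter, Finset.mem_univ, true_and,
      Finset.forall_mem_insert, Finset.union_subset_iff]
    tauto
  · rw [Finset.disjoint_filter]
    intro G _ h1 h2
    exact h1.2 t (Finset.mem_insert_self _ _) (Finset.union_subset_iff.1 h2.1).2

lemma gasZ_insert_filter {f : E} (hf : f ∉ S) :
    gasZ lam (insert f S) (T.filter (f ∉ ·)) =
      lam * (gasZ lam S T - gasZ lam (insert f S) T) := by
  have h1 : gasZ lam S T - gasZ lam (insert f S) T =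
      ∑ G : Finset E with f ∉ G ∧ S ⊆ G ∧ ∀ t ∈ T, ¬ t ⊆ G, lam ^ G.card := by
    rw [sub_eq_iff_eq_add]
    unfold gasZ
    rw [← Finset.sum_union]
    · congr 1
      ext G
      simp only [Finset.mem_union, Finset.mem_filter, Finset.mem_univ, true_and,
        Finset.insert_subset_iff]
      tauto
    · rw [Finset.disjoint_filter]
      intro G _ h1 h2
      exact h1.1 (h2.1 (Finset.mem_insert_self _ _))
  rw [h1, Finset.mul_sum]
  unfold gasZ
  refine Finset.sum_bij' (fun G _ => G.erase f) (fun G _ => insert f G) ?_ ?_ ?_ ?_ ?_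
  · intro G hG
    simp only [Finset.mem_filter, Finset.mem_univ, true_and, Finset.insert_subset_iff] at hG ⊢
    refine ⟨Finset.notMem_erase _ _, Finset.subset_erase.2 ⟨hG.1.2, hf⟩, fun t ht hs => ?_⟩
    have := Finset.subset_erase.1 hs
    exact hG.2 t ⟨ht, this.2⟩ this.1
  · intro G hG
    simp only [Finset.mem_filter, Finset.mem_univ, true_and] at hG ⊢
    refine ⟨Finset.insert_subset_insert _ hG.2.1, fun t ht hs => hG.2.2 t ht.1 ?_⟩
    exact (Finset.subset_insert_iff_of_notMem ht.2).1 hs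
  · intro G hG
    simp only [Finset.mem_filter, Finset.mem_univ, true_and, Finset.insert_subset_iff] at hG
    exact Finset.insert_erase hG.1.1
  · intro G hG
    simp only [Finset.mem_filter, Finset.mem_univ, true_and] at hG
    exact Finset.erase_insert hG.1
  · intro G hG
    simp only [Finset.mem_filter, Finset.mem_univ, true_and, Finset.insert_subset_iff] at hG
    rw [← pow_succ', Finset.card_erase_add_one hG.1.1]

lemma prod_mul_gasZ_le_gasZ_union (B : Finset (Finset E)) (u : Finset E → ℝ)
    (hu : ∀ t ∈ B, u t ≤ 1)
    (h : ∀ t ∈ B, ∀ B' ⊆ B, t ∉ B' →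
      gasZ lam (S ∪ t) (T ∪ B') ≤ u t * gasZ lam S (T ∪ B')) :
    (∏ t ∈ B, (1 - u t)) * gasZ lam S T ≤ gasZ lam S (T ∪ B) := by
  induction B using Finset.induction_on with
  | empty => simp
  | insert t B ht ih =>
    have h1 := ih (fun s hs => hu s (Finset.mem_insert_of_mem hs))
      (fun s hs B' hB' => h s (Finset.mem_insert_of_mem hs) B'
        (hB'.trans (Finset.subset_insert _ _)))
    have h2 := h t (Finset.mem_insert_self _ _) B (Finset.subset_insert _ _) ht
    have h3 := hu t (Finset.mem_insert_self _ _)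
    rw [Finset.prod_insert ht, Finset.union_insert, gasZ_insert_right, mul_assoc]
    have := mul_le_mul_of_nonneg_left h1 (sub_nonneg.2 h3)
    linarith

lemma gasZ_union_le_prod_mul_gasZ (B : Finset (Finset E)) (u : Finset E → ℝ)
    (hu : ∀ t ∈ B, u t ≤ 1)
    (h : ∀ t ∈ B, ∀ B' ⊆ B, t ∉ B' →
      u t * gasZ lam S (T ∪ B') ≤ gasZ lam (S ∪ t) (T ∪ B')) :
    gasZ lam S (T ∪ B) ≤ (∏ t ∈ B, (1 - u t)) * gasZ lam S T := by
  induction B using Finset.induction_on with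
  | empty => simp
  | insert t B ht ih =>
    have h1 := ih (fun s hs => hu s (Finset.mem_insert_of_mem hs))
      (fun s hs B' hB' => h s (Finset.mem_insert_of_mem hs) B'
        (hB'.trans (Finset.subset_insert _ _)))
    have h2 := h t (Finset.mem_insert_self _ _) B (Finset.subset_insert _ _) ht
    have h3 := hu t (Finset.mem_insert_self _ _)
    rw [Finset.prod_insert ht, Finset.union_insert, gasZ_insert_right, mul_assoc]
    have := mul_le_mul_of_nonneg_left h1 (sub_nonneg.2 h3)
    linarith

/-- Occupation probabilities are at most `U`, uniformly over near-full conditionings. -/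
def OccLe (lam : ℝ) (H : Finset (Finset E)) (k : ℕ) (U : ℝ) : Prop :=
  ∀ S T, NearFull H k S T → ∀ f ∉ S, gasZ lam (insert f S) T ≤ U * gasZ lam S T

/-- Occupation probabilities of unblocked vertices are at least `L`, uniformly over near-full
conditionings. -/
def OccGe (lam : ℝ) (H : Finset (Finset E)) (k : ℕ) (L : ℝ) : Prop :=
  ∀ S T, NearFull H k S T → ∀ f ∉ S, (∀ t ∈ T, f ∈ t → ¬ t ⊆ insert f S) →
    L * gasZ lam S T ≤ gasZ lam (insert f S) T

lemma OccLe.occGe {D k : ℕ} {U : ℝ} (hH : IsLinearTriples H D) (hl : 0 ≤ lam) (hU : 0 ≤ U)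
    (hU1 : U ≤ 1) (h : OccLe lam H (k + 2) U) :
    OccGe lam H k (lam / (1 + lam) * ((1 - U ^ 2) ^ D * (1 - U) ^ k)) := by
  intro S T hST f hf hfree
  set u : Finset E → ℝ := fun t => if Disjoint t S then U ^ 2 else U with hu
  have hU2 : U ^ 2 ≤ 1 := pow_le_one₀ hU hU1
  have key := prod_mul_gasZ_le_gasZ_union (lam := lam) (S := insert f S)
    (T := T.filter (f ∉ ·)) (T.filter (f ∈ ·)) u
    (fun t _ => by simp only [hu]; split_ifs <;> assumption) (by
      intro t ht B hB htB
      have hn := hST.insert_filter_union f (hB.trans (Finset.filter_subset _ _))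
      set T' := T.filter (f ∉ ·) ∪ B
      rw [Finset.mem_filter] at ht
      obtain ⟨a, b, ha, hb, hab, rfl⟩ := exists_eq_triple (hH.card_eq t (hST.2.1 ht.1)) ht.2
      simp only [hu]
      split_ifs with hd
      · simp only [Finset.disjoint_insert_left, Finset.disjoint_singleton_left] at hd
        have h1 := h _ T' (hn.insert a) b (by simp [hb, hab.symm, hd.2.2])
        have h2 := h (insert f S) T' ⟨hn.1.trans (by omega), hn.2⟩ a (by simp [ha, hd.2.1])
        have h3 : insert f S ∪ {f, a, b} = insert b (insert a (insert f S)) := by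
          ext; simp; tauto
        rw [h3, pow_two, mul_assoc]
        exact h1.trans (mul_le_mul_of_nonneg_left h2 hU)
      · have h4 := hfree _ ht.1 ht.2
        obtain ⟨x, hx, hxS⟩ := Finset.not_subset.1 h4
        refine (gasZ_anti hl (S := insert x (insert f S)) ?_).trans
          (h (insert f S) T' ⟨hn.1.trans (by omega), hn.2⟩ x hxS)
        exact Finset.insert_subset (Finset.mem_union_right _ hx) Finset.subset_union_left)
  rw [filter_notMem_union_filter_mem, gasZ_insert_filter hf] at key
  have hprod : (1 - U ^ 2) ^ D * (1 - U) ^ k ≤ ∏ t ∈ T.filter (f ∈ ·), (1 - u t) := by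
    have : ∀ t, 1 - u t = if Disjoint t S then 1 - U ^ 2 else 1 - U := by
      intro t; simp only [hu]; split_ifs <;> rfl
    simp_rw [this]
    rw [Finset.prod_ite, Finset.prod_const, Finset.prod_const]
    refine mul_le_mul (pow_le_pow_of_le_one (by linarith) (by nlinarith) ?_)
      (pow_le_pow_of_le_one (by linarith) (by linarith) ?_)
      (pow_nonneg (by linarith) _) (pow_nonneg (by linarith) _)
    · rw [← hH.degree f]
      exact Finset.card_le_card ((Finset.filter_subset _ _).trans
        (Finset.filter_subset_filter _ hST.2.1))
    · refine le_trans (Finset.card_le_card ?_) ((hH.card_meeting_le hf).trans hST.1)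
      rw [Finset.filter_filter]
      exact Finset.filter_subset_filter _ hST.2.1
  set r := (1 - U ^ 2) ^ D * (1 - U) ^ k
  have hr1 : r ≤ 1 := mul_le_one₀ (pow_le_one₀ (by linarith) (by nlinarith))
    (pow_nonneg (by linarith) _) (pow_le_one₀ (by linarith) (by linarith))
  have ha := gasZ_nonneg (S := insert f S) (T := T) hl
  have hd : 0 ≤ gasZ lam S T - gasZ lam (insert f S) T :=
    sub_nonneg.2 (gasZ_anti hl (Finset.subset_insert _ _))
  have h5 := (mul_le_mul_of_nonneg_right hprod (mul_nonneg hl hd)).trans key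
  rw [div_mul_eq_mul_div, div_mul_eq_mul_div, div_le_iff₀ (by linarith)]
  nlinarith [mul_le_mul_of_nonneg_right hr1 (mul_nonneg hl ha)]

lemma OccGe.occLe {D k : ℕ} {L : ℝ} (hH : IsLinearTriples H D) (hl : 0 ≤ lam) (hL : 0 ≤ L)
    (hL1 : L ≤ 1) (h : OccGe lam H (k + 2) L) :
    OccLe lam H k (lam * (1 - L ^ 2) ^ (D - (k + k ^ 2))) := by
  intro S T hST f hf
  set good : Finset E → Prop := fun t => Disjoint t S ∧
    ∀ h ∈ H, f ∉ h → ¬ Disjoint h t → ¬ h ⊆ S ∪ t with hgood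
  set u : Finset E → ℝ := fun t => if good t then L ^ 2 else 0 with hu
  have hL2 : L ^ 2 ≤ 1 := pow_le_one₀ hL hL1
  have key := gasZ_union_le_prod_mul_gasZ (lam := lam) (S := insert f S)
    (T := T.filter (f ∉ ·)) (T.filter (f ∈ ·)) u
    (fun t _ => by simp only [hu]; split_ifs <;> linarith) (by
      intro t ht B hB htB
      have hn := hST.insert_filter_union f (hB.trans (Finset.filter_subset _ _))
      have htT : t ∉ T.filter (f ∉ ·) ∪ B := by
        rw [Finset.mem_filter] at ht
        simp [htB, ht.2]
      set T' := T.filter (f ∉ ·) ∪ B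
      rw [Finset.mem_filter] at ht
      have htH := hST.2.1 ht.1
      simp only [hu]
      split_ifs with hg
      · obtain ⟨a, b, ha, hb, hab, rfl⟩ := exists_eq_triple (hH.card_eq t htH) ht.2
        obtain ⟨hd, hg⟩ := hg
        have hfree : ∀ x ∈ ({f, a, b} : Finset E), x ≠ f → ∀ t ∈ T', x ∈ t →
            ¬ t ⊆ S ∪ {f, a, b} := by
          intro x hx hxf t' ht' hxt
          have ht'H := hn.2.1 ht'
          by_cases hft : f ∈ t'
          · have := hH.eq_of_mem _ htH _ ht'H x f hxf hx (by simp) hxt hft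
            exact absurd (this ▸ ht') htT
          · exact hg t' ht'H hft (Finset.not_disjoint_iff.2 ⟨x, hxt, hx⟩)
        simp only [Finset.disjoint_insert_left, Finset.disjoint_singleton_left] at hd
        have h1 := h _ T' (hn.insert a) b (by simp [hb, hab.symm, hd.2.2]) (by
          intro t' ht' hbt hs
          refine hfree b (by simp) hb t' ht' hbt (hs.trans ?_)
          intro y; simp; tauto)
        have h2 := h (insert f S) T' ⟨hn.1.trans (by omega), hn.2⟩ a (by simp [ha, hd.2.1]) (by
          intro t' ht' hbt hs
          refine hfree a (by simp) ha t' ht' hbt (hs.trans ?_)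
          intro y; simp; tauto)
        have h3 : insert f S ∪ {f, a, b} = insert b (insert a (insert f S)) := by
          ext; simp; tauto
        rw [h3, pow_two, mul_assoc]
        exact (mul_le_mul_of_nonneg_left h2 hL).trans h1
      · rw [zero_mul]
        exact gasZ_nonneg hl)
  rw [filter_notMem_union_filter_mem, gasZ_insert_filter hf] at key
  have hcard : D - (k + k ^ 2) ≤ ((T.filter (f ∈ ·)).filter good).card := by
    have hsub : H.filter (f ∈ ·) ⊆ (T.filter (f ∈ ·)).filter good ∪
        (H.filter (fun t => f ∈ t ∧ ¬ Disjoint t S) ∪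
        H.filter (fun t => f ∈ t ∧ Disjoint t S ∧
          ∃ h ∈ H, f ∉ h ∧ ¬ Disjoint h t ∧ h ⊆ S ∪ t)) := by
      intro t ht
      simp only [Finset.mem_union, Finset.mem_filter, hgood] at ht ⊢
      by_cases hd : Disjoint t S
      · have htT : t ∈ T := by
          by_contra hc
          exact hST.2.2 t ht.1 hc hd
        by_cases hx : ∃ h ∈ H, f ∉ h ∧ ¬ Disjoint h t ∧ h ⊆ S ∪ t
        · exact Or.inr (Or.inr ⟨ht.1, ht.2, hd, hx⟩)
        · exact Or.inl ⟨⟨htT, ht.2⟩, hd, fun h hh h1 h2 h3 => hx ⟨h, hh, h1, h2, h3⟩⟩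
      · exact Or.inr (Or.inl ⟨ht.1, ht.2, hd⟩)
    have h1 := Finset.card_le_card hsub
    have h2 := Finset.card_union_le ((T.filter (f ∈ ·)).filter good)
        (H.filter (fun t => f ∈ t ∧ ¬ Disjoint t S) ∪
        H.filter (fun t => f ∈ t ∧ Disjoint t S ∧
          ∃ h ∈ H, f ∉ h ∧ ¬ Disjoint h t ∧ h ⊆ S ∪ t))
    have h3 := Finset.card_union_le (H.filter (fun t => f ∈ t ∧ ¬ Disjoint t S))
        (H.filter (fun t => f ∈ t ∧ Disjoint t S ∧
          ∃ h ∈ H, f ∉ h ∧ ¬ Disjoint h t ∧ h ⊆ S ∪ t))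
    have h4 := hH.card_meeting_le hf
    have h5 := hH.card_blocking_le (S := S) f
    have h6 := Nat.pow_le_pow_left hST.1 2
    have h7 := hST.1
    rw [hH.degree f] at h1
    omega
  have hprod : ∏ t ∈ T.filter (f ∈ ·), (1 - u t) ≤ (1 - L ^ 2) ^ (D - (k + k ^ 2)) := by
    have : ∀ t, 1 - u t = if good t then 1 - L ^ 2 else 1 := by
      intro t; simp only [hu]; split_ifs <;> simp
    simp_rw [this]
    rw [Finset.prod_ite, Finset.prod_const, Finset.prod_const, one_pow, mul_one]
    exact pow_le_pow_of_le_one (by linarith) (by nlinarith) hcard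
  set r := (1 - L ^ 2) ^ (D - (k + k ^ 2))
  have hr0 : 0 ≤ r := pow_nonneg (by linarith) _
  have ha := gasZ_nonneg (S := insert f S) (T := T) hl
  have hd : 0 ≤ gasZ lam S T - gasZ lam (insert f S) T :=
    sub_nonneg.2 (gasZ_anti hl (Finset.subset_insert _ _))
  have h5 := key.trans (mul_le_mul_of_nonneg_right hprod (mul_nonneg hl hd))
  nlinarith [mul_nonneg hr0 (mul_nonneg hl ha)]

lemma occGe_zero (hl : 0 ≤ lam) (k : ℕ) : OccGe lam H k 0 := by
  intro S T _ f _ _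
  rw [zero_mul]
  exact gasZ_nonneg hl

end HypergraphGas

section TriangleHypergraph

/-- The potential edges of a graph on `Fin n`. -/
abbrev Pair (n : ℕ) : Type := {e : Sym2 (Fin n) // ¬ e.IsDiag}

/-- The potential edges spanned by a vertex set. -/
def pairsIn {n : ℕ} (s : Finset (Fin n)) : Finset (Pair n) :=
  Finset.univ.filter fun e => e.1 ∈ s.sym2

/-- The hypergraph on the potential edges whose members are the triangles of `K_n`. -/
def triangles (n : ℕ) : Finset (Finset (Pair n)) :=
  (Finset.powersetCard 3 Finset.univ).image pairsIn

variable {n : ℕ}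

lemma mem_pairsIn {s : Finset (Fin n)} {e : Pair n} : e ∈ pairsIn s ↔ ∀ v ∈ e.1, v ∈ s := by
  simp [pairsIn, Finset.mem_sym2_iff]

lemma mem_triangles {t : Finset (Pair n)} :
    t ∈ triangles n ↔ ∃ s : Finset (Fin n), s.card = 3 ∧ pairsIn s = t := by
  simp [triangles, Finset.mem_powersetCard]

lemma card_pairsIn (s : Finset (Fin n)) : (pairsIn s).card = s.card.choose 2 := by
  rw [← Sym2.card_image_offDiag, ← Finset.card_map (Function.Embedding.subtype _)]
  congr 1
  ext e
  induction e using Sym2.ind with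
  | _ x y =>
    simp only [Finset.mem_map, Function.Embedding.coe_subtype, mem_pairsIn, Finset.mem_image,
      Finset.mem_offDiag]
    constructor
    · rintro ⟨⟨e, he⟩, h1, rfl⟩
      exact ⟨(x, y), ⟨h1 x (by simp), h1 y (by simp), by simpa using he⟩, rfl⟩
    · rintro ⟨⟨a, b⟩, ⟨ha, hb, hab⟩, h⟩
      refine ⟨⟨s(a, b), by simpa using hab⟩, fun v hv => ?_, h⟩
      rcases Sym2.mem_iff.1 hv with rfl | rfl
      · exact ha
      · exact hb

lemma card_pair : Fintype.card (Pair n) = n.choose 2 := by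
  rw [Sym2.card_subtype_not_diag, Fintype.card_fin]

lemma exists_eq_of_pairsIn {e e' : Pair n} (h : e ≠ e') :
    ∃ r : Finset (Fin n), ∀ s : Finset (Fin n), s.card = 3 → e ∈ pairsIn s → e' ∈ pairsIn s →
      s = r := by
  obtain ⟨e, he⟩ := e
  obtain ⟨e', he'⟩ := e'
  have h' : ¬ ∀ v ∈ e', v ∈ e := by
    intro hv
    apply h
    rw [Subtype.mk_eq_mk]
    induction e using Sym2.ind with
    | _ a b =>
      induction e' using Sym2.ind with
      | _ c d =>
        have hc := hv c (by simp)
        have hd := hv d (by simp)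
        simp only [Sym2.mk_isDiag_iff, Sym2.mem_iff] at he' hc hd
        rw [Sym2.eq_iff]
        rcases hc with rfl | rfl <;> rcases hd with rfl | rfl <;> simp_all
  push Not at h'
  obtain ⟨z, hz, hze⟩ := h'
  induction e using Sym2.ind with
  | _ a b =>
    simp only [Sym2.mk_isDiag_iff, Sym2.mem_iff, not_or] at he hze
    refine ⟨{a, b, z}, fun s hs h1 h2 => ?_⟩
    rw [mem_pairsIn] at h1 h2
    symm
    apply Finset.eq_of_subset_of_card_le
    · intro v hv
      simp only [Finset.mem_insert, Finset.mem_singleton] at hv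
      rcases hv with rfl | rfl | rfl
      · exact h1 _ (by simp)
      · exact h1 _ (by simp)
      · exact h2 _ hz
    · rw [hs, Finset.card_eq_three.2 ⟨a, b, z, he, Ne.symm hze.1, Ne.symm hze.2, rfl⟩]

lemma card_triangles_filter_mem (f : Pair n) :
    ((triangles n).filter (f ∈ ·)).card = n - 2 := by
  obtain ⟨f, hf⟩ := f
  induction f using Sym2.ind with
  | _ u v =>
    have huv : u ≠ v := by simpa using hf
    have h1 : (triangles n).filter (⟨s(u, v), hf⟩ ∈ ·) =
        ((Finset.univ : Finset (Fin n)) \ {u, v}).image fun w => pairsIn {u, v, w} := by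
      ext t
      simp only [Finset.mem_filter, mem_triangles, Finset.mem_image, Finset.mem_sdiff,
        Finset.mem_univ, true_and]
      constructor
      · rintro ⟨⟨s, hs, rfl⟩, hm⟩
        rw [mem_pairsIn] at hm
        have hu := hm u (by simp)
        have hv := hm v (by simp)
        obtain ⟨a, b, ha, hb, hab, rfl⟩ := exists_eq_triple hs hu
        simp only [Finset.mem_insert, Finset.mem_singleton] at hv
        rcases hv with rfl | rfl | rfl
        · exact absurd rfl huv
        · exact ⟨b, by simp [hb, hab.symm], rfl⟩
        · exact ⟨a, by simp [ha, hab], by rw [Finset.pair_comm]⟩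
      · rintro ⟨w, hw, rfl⟩
        simp only [Finset.mem_insert, Finset.mem_singleton, not_or] at hw
        exact ⟨⟨_, Finset.card_eq_three.2 ⟨u, v, w, huv, Ne.symm hw.1, Ne.symm hw.2, rfl⟩, rfl⟩,
          mem_pairsIn.2 (by simp)⟩
    rw [h1, Finset.card_image_of_injOn]
    · rw [Finset.card_sdiff_of_subset (Finset.subset_univ _), Finset.card_pair huv]
      simp
    · intro w hw w' hw' h
      simp only [Finset.coe_sdiff, Set.mem_sdiff, Finset.mem_coe, Finset.mem_univ, true_and,
        Finset.mem_insert, Finset.mem_singleton, not_or] at hw hw'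
      have h2 : (⟨s(u, w), by simpa using Ne.symm hw.1⟩ : Pair n) ∈ pairsIn {u, v, w} :=
        mem_pairsIn.2 (by simp)
      simp only at h
      rw [h, mem_pairsIn] at h2
      have := h2 w (by simp)
      simp only [Finset.mem_insert, Finset.mem_singleton] at this
      tauto

lemma isLinearTriples_triangles (n : ℕ) : IsLinearTriples (triangles n) (n - 2) where
  card_eq t ht := by
    obtain ⟨s, hs, rfl⟩ := mem_triangles.1 ht
    rw [card_pairsIn, hs]
    rfl
  eq_of_mem t ht t' ht' a b hab h1 h2 h3 h4 := by
    obtain ⟨s, hs, rfl⟩ := mem_triangles.1 ht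
    obtain ⟨s', hs', rfl⟩ := mem_triangles.1 ht'
    obtain ⟨r, hr⟩ := exists_eq_of_pairsIn hab
    rw [hr s hs h1 h2, hr s' hs' h3 h4]
  degree := card_triangles_filter_mem

end TriangleHypergraph

section Asymptotics

open Topology

lemma tendsto_sqrt_natCast : Tendsto (fun n : ℕ => √(n : ℝ)) atTop atTop :=
  Real.tendsto_sqrt_atTop.comp tendsto_natCast_atTop_atTop

lemma tendsto_div_sqrt {a : ℕ → ℝ} {l : ℝ} (ha : Tendsto a atTop (𝓝 l)) :
    Tendsto (fun n : ℕ => a n / √n) atTop (𝓝 0) :=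
  ha.div_atTop tendsto_sqrt_natCast

lemma tendsto_one_sub_sq_pow {a : ℕ → ℝ} {l : ℝ} (ha : Tendsto a atTop (𝓝 l)) (m : ℕ) :
    Tendsto (fun n : ℕ => (1 - (a n / √n) ^ 2) ^ (n - m)) atTop (𝓝 (Real.exp (-l ^ 2))) := by
  have hpos : ∀ᶠ n : ℕ in atTop, 0 < n := eventually_gt_atTop 0
  have h1 : Tendsto (fun n : ℕ => (n : ℝ) * (-(a n / √n) ^ 2)) atTop (𝓝 (-l ^ 2)) := by
    refine (ha.pow 2).neg.congr' ?_
    filter_upwards [hpos] with n hn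
    have : (0 : ℝ) < n := by exact_mod_cast hn
    rw [div_pow, Real.sq_sqrt this.le]
    field_simp
  have h2 := Real.tendsto_one_add_pow_exp_of_tendsto h1
  have h3 : Tendsto (fun n : ℕ => 1 + -(a n / √n) ^ 2) atTop (𝓝 1) := by
    simpa using ((tendsto_div_sqrt ha).pow 2).neg.const_add 1
  have h4 := h2.div (h3.pow m) (by simp)
  rw [one_pow, div_one] at h4
  refine h4.congr' ?_
  filter_upwards [eventually_ge_atTop m, h3.eventually_ne one_ne_zero] with n hn hne
  simp only [Pi.div_apply]
  rw [div_eq_iff (pow_ne_zero _ hne), ← sub_eq_add_neg, ← pow_add, Nat.sub_add_cancel hn]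

/-- Edge probabilities are asymptotically at least `l / √n`. -/
def AsympGe (lam : ℕ → ℝ) (k : ℕ) (l : ℝ) : Prop :=
  ∃ a : ℕ → ℝ, Tendsto a atTop (𝓝 l) ∧
    ∀ᶠ n in atTop, 0 ≤ a n ∧ OccGe (lam n) (triangles n) k (a n / √n)

/-- Edge probabilities are asymptotically at most `l / √n`. -/
def AsympLe (lam : ℕ → ℝ) (k : ℕ) (l : ℝ) : Prop :=
  ∃ a : ℕ → ℝ, Tendsto a atTop (𝓝 l) ∧
    ∀ᶠ n in atTop, 0 ≤ a n ∧ OccLe (lam n) (triangles n) k (a n / √n)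

variable {lam : ℕ → ℝ} {c l : ℝ} {k : ℕ}

lemma AsympGe.asympLe (hl : ∀ᶠ n in atTop, 0 ≤ lam n)
    (hc : Tendsto (fun n : ℕ => √n * lam n) atTop (𝓝 c)) (h : AsympGe lam (k + 2) l) :
    AsympLe lam k (c * Real.exp (-l ^ 2)) := by
  obtain ⟨a, ha, hocc⟩ := h
  refine ⟨fun n => √n * lam n * (1 - (a n / √n) ^ 2) ^ (n - (2 + (k + k ^ 2))),
    hc.mul (tendsto_one_sub_sq_pow ha _), ?_⟩
  filter_upwards [hl, hocc, eventually_gt_atTop 0,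
    (tendsto_div_sqrt ha).eventually_le_const one_pos] with n h0 h1 hn h2
  have hs : 0 < √(n : ℝ) := Real.sqrt_pos.2 (by exact_mod_cast hn)
  have ha0 : 0 ≤ a n / √n := div_nonneg h1.1 hs.le
  have := h1.2.occLe (isLinearTriples_triangles n) h0 ha0 h2
  refine ⟨mul_nonneg (mul_nonneg hs.le h0)
    (pow_nonneg (sub_nonneg.2 (pow_le_one₀ ha0 h2)) _), ?_⟩
  rw [mul_assoc, mul_div_cancel_left₀ _ hs.ne', ← Nat.sub_sub]
  exact this

lemma AsympLe.asympGe (hl : ∀ᶠ n in atTop, 0 ≤ lam n)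
    (hc : Tendsto (fun n : ℕ => √n * lam n) atTop (𝓝 c)) (h : AsympLe lam (k + 2) l) :
    AsympGe lam k (c * Real.exp (-l ^ 2)) := by
  obtain ⟨a, ha, hocc⟩ := h
  have hlam : Tendsto lam atTop (𝓝 0) := by
    refine (tendsto_div_sqrt hc).congr' ?_
    filter_upwards [eventually_gt_atTop 0] with n hn
    have hs : 0 < √(n : ℝ) := Real.sqrt_pos.2 (by exact_mod_cast hn)
    field_simp
  have h1 : Tendsto (fun n : ℕ => √n * lam n / (1 + lam n)) atTop (𝓝 c) := by
    have := hc.div (hlam.const_add 1) (by simp)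
    rwa [add_zero, div_one] at this
  have h2 : Tendsto (fun n : ℕ => (1 - a n / √n) ^ k) atTop (𝓝 1) := by
    simpa using ((tendsto_div_sqrt ha).const_sub 1).pow k
  refine ⟨fun n => √n * lam n / (1 + lam n) * ((1 - (a n / √n) ^ 2) ^ (n - 2) *
    (1 - a n / √n) ^ k), by simpa using h1.mul ((tendsto_one_sub_sq_pow ha 2).mul h2), ?_⟩
  filter_upwards [hl, hocc, eventually_gt_atTop 0,
    (tendsto_div_sqrt ha).eventually_le_const one_pos] with n h0 h1 hn h2
  have hs : 0 < √(n : ℝ) := Real.sqrt_pos.2 (by exact_mod_cast hn)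
  have ha0 : 0 ≤ a n / √n := div_nonneg h1.1 hs.le
  have := h1.2.occGe (isLinearTriples_triangles n) h0 ha0 h2
  refine ⟨mul_nonneg (div_nonneg (mul_nonneg hs.le h0) (by linarith)) (mul_nonneg
    (pow_nonneg (sub_nonneg.2 (pow_le_one₀ ha0 h2)) _) (pow_nonneg (by linarith) _)), ?_⟩
  have heq : √(n : ℝ) * lam n / (1 + lam n) * ((1 - (a n / √n) ^ 2) ^ (n - 2) *
      (1 - a n / √n) ^ k) / √n =
      lam n / (1 + lam n) * ((1 - (a n / √n) ^ 2) ^ (n - 2) * (1 - a n / √n) ^ k) := by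
    field_simp
  rw [heq]
  exact this

lemma abs_exp_neg_sq_sub_le (x y : ℝ) :
    |Real.exp (-x ^ 2) - Real.exp (-y ^ 2)| ≤ |x - y| := by
  have hd : ∀ z : ℝ, HasDerivAt (fun z : ℝ => Real.exp (-z ^ 2))
      (Real.exp (-z ^ 2) * (-(2 * z))) z := fun z => by
    simpa using ((hasDerivAt_pow 2 z).neg).exp
  have := Convex.norm_image_sub_le_of_norm_hasDerivWithin_le (C := 1)
    (fun z _ => (hd z).hasDerivWithinAt (s := Set.univ)) (fun z _ => ?_) convex_univ
    (Set.mem_univ y) (Set.mem_univ x)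
  · simpa [Real.norm_eq_abs] using this
  · rw [norm_mul, Real.norm_eq_abs, Real.norm_eq_abs, Real.abs_exp, Real.exp_neg,
      inv_mul_le_iff₀ (Real.exp_pos _), mul_one]
    refine le_trans ?_ (Real.add_one_le_exp _)
    rw [abs_le]
    constructor <;> nlinarith [sq_nonneg (z - 1), sq_nonneg (z + 1)]

/-- Two steps of the mean-field recursion `y ↦ c * exp (-y ^ 2)`, iterated from `0`. -/
def meanFieldIter (c : ℝ) : ℕ → ℝ
  | 0 => 0
  | r + 1 => c * Real.exp (-(c * Real.exp (-(meanFieldIter c r) ^ 2)) ^ 2)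

lemma asympGe_meanFieldIter (hl : ∀ᶠ n in atTop, 0 ≤ lam n)
    (hc : Tendsto (fun n : ℕ => √n * lam n) atTop (𝓝 c)) (r : ℕ) :
    ∀ k, AsympGe lam k (meanFieldIter c r) := by
  induction r with
  | zero =>
    intro k
    refine ⟨fun _ => 0, tendsto_const_nhds, ?_⟩
    filter_upwards [hl] with n hn
    rw [zero_div]
    exact ⟨le_rfl, occGe_zero hn k⟩
  | succ r ih => exact fun k => ((ih _).asympLe hl hc).asympGe hl hc

lemma tendsto_meanFieldIter {t : ℝ} (hc0 : 0 ≤ c) (hc1 : c < 1)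
    (ht : c * Real.exp (-t ^ 2) = t) :
    Tendsto (meanFieldIter c) atTop (𝓝 t) := by
  have hstep : ∀ y, |c * Real.exp (-y ^ 2) - t| ≤ c * |y - t| := fun y => by
    nth_rewrite 1 [← ht]
    rw [← mul_sub, abs_mul, abs_of_nonneg hc0]
    exact mul_le_mul_of_nonneg_left (abs_exp_neg_sq_sub_le y t) hc0
  have hbd : ∀ r, |meanFieldIter c r - t| ≤ c ^ r * |t| := fun r => by
    induction r with
    | zero => simp [meanFieldIter]
    | succ r ih =>
      calc |meanFieldIter c (r + 1) - t|
          ≤ c * |c * Real.exp (-(meanFieldIter c r) ^ 2) - t| := hstep _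
        _ ≤ c * (1 * |meanFieldIter c r - t|) := by
          refine mul_le_mul_of_nonneg_left ((hstep _).trans ?_) hc0
          exact mul_le_mul_of_nonneg_right hc1.le (abs_nonneg _)
        _ ≤ c ^ (r + 1) * |t| := by
          rw [one_mul, pow_succ', mul_assoc]
          exact mul_le_mul_of_nonneg_left ih hc0
  rw [tendsto_iff_norm_sub_tendsto_zero]
  refine squeeze_zero (fun _ => norm_nonneg _) hbd ?_
  simpa using (tendsto_pow_atTop_nhds_zero_of_lt_one hc0 hc1).mul_const |t|

/-- The partition function of triangle-free graphs on `n` labelled vertices. -/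
def triFreeZ (n : ℕ) (lam : ℝ) : ℝ := gasZ lam ∅ (triangles n)

/-- The expected number of edges in the Gibbs measure on triangle-free graphs. -/
def triFreeMean (n : ℕ) (lam : ℝ) : ℝ :=
  (∑ f : Pair n, gasZ lam {f} (triangles n)) / triFreeZ n lam

lemma nearFull_empty (n k : ℕ) : NearFull (triangles n) k ∅ (triangles n) :=
  ⟨by simp, subset_rfl, fun _ h h' => absurd h h'⟩

lemma triFreeZ_pos (n : ℕ) {lam : ℝ} (hl : 0 ≤ lam) : 0 < triFreeZ n lam := by
  have h : (1 : ℝ) ≤ triFreeZ n lam := by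
    unfold triFreeZ gasZ
    refine le_trans (by simp) (Finset.single_le_sum (f := fun G : Finset (Pair n) => lam ^ G.card)
      (fun _ _ => by positivity) (a := ∅) ?_)
    simp only [Finset.mem_filter, Finset.mem_univ, subset_refl, true_and,
      Finset.subset_empty]
    rintro t ht rfl
    simpa using (isLinearTriples_triangles n).card_eq _ ht
  linarith

lemma OccLe.triFreeMean_le {n k : ℕ} {lam U : ℝ} (hl : 0 ≤ lam)
    (h : OccLe lam (triangles n) k U) : triFreeMean n lam ≤ n.choose 2 * U := by
  rw [triFreeMean, div_le_iff₀ (triFreeZ_pos n hl)]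
  refine (Finset.sum_le_sum fun f _ => h ∅ _ (nearFull_empty n k) f (by simp)).trans ?_
  rw [Finset.sum_const, Finset.card_univ, card_pair, nsmul_eq_mul, mul_assoc, triFreeZ]

lemma OccGe.le_triFreeMean {n k : ℕ} {lam L : ℝ} (hl : 0 ≤ lam)
    (h : OccGe lam (triangles n) k L) : n.choose 2 * L ≤ triFreeMean n lam := by
  rw [triFreeMean, le_div_iff₀ (triFreeZ_pos n hl)]
  refine le_trans ?_ (Finset.sum_le_sum fun f _ => h ∅ _ (nearFull_empty n k) f (by simp) ?_)
  · rw [Finset.sum_const, Finset.card_univ, card_pair, nsmul_eq_mul, mul_assoc, triFreeZ]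
  · intro t ht _ hs
    have h1 := Finset.card_le_card hs
    rw [(isLinearTriples_triangles n).card_eq _ ht] at h1
    simp at h1

lemma triFreeMean_le (n : ℕ) {lam : ℝ} (hl : 0 ≤ lam) :
    triFreeMean n lam ≤ n.choose 2 * lam := by
  refine OccLe.triFreeMean_le (k := 0) hl ?_
  simpa using (occGe_zero hl 2).occLe (k := 0) (isLinearTriples_triangles n) hl le_rfl zero_le_one

lemma triFreeMean_nonneg (n : ℕ) {lam : ℝ} (hl : 0 ≤ lam) : 0 ≤ triFreeMean n lam :=
  div_nonneg (Finset.sum_nonneg fun _ _ => gasZ_nonneg hl) (triFreeZ_pos n hl).le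

lemma tendsto_triFreeMean {t : ℝ} (hl : ∀ᶠ n in atTop, 0 ≤ lam n)
    (hc : Tendsto (fun n : ℕ => √n * lam n) atTop (𝓝 c)) (hc0 : 0 ≤ c) (hc1 : c < 1)
    (ht : c * Real.exp (-t ^ 2) = t) :
    Tendsto (fun n : ℕ => √n * (triFreeMean n (lam n) / n.choose 2)) atTop (𝓝 t) := by
  have hiter := tendsto_meanFieldIter hc0 hc1 ht
  have hpos : ∀ᶠ n : ℕ in atTop, 0 < √(n : ℝ) ∧ (0 : ℝ) < n.choose 2 := by
    filter_upwards [eventually_ge_atTop 2] with n hn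
    exact ⟨Real.sqrt_pos.2 (by exact_mod_cast (by omega : 0 < n)),
      by exact_mod_cast Nat.choose_pos hn⟩
  rw [tendsto_order]
  constructor
  · intro x hx
    obtain ⟨r, hr⟩ := (hiter.eventually_const_lt hx).exists
    obtain ⟨a, ha, hocc⟩ := asympGe_meanFieldIter hl hc r 0
    filter_upwards [hl, hocc, hpos, ha.eventually_const_lt hr] with n h0 h1 h2 h3
    refine h3.trans_le ?_
    rw [← div_le_iff₀' h2.1, le_div_iff₀' h2.2]
    exact h1.2.le_triFreeMean h0
  · intro x hx
    have hiter' : Tendsto (fun r => c * Real.exp (-(meanFieldIter c r) ^ 2)) atTop (𝓝 t) := by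
      have h := ((Real.continuous_exp.tendsto _).comp (hiter.pow 2).neg).const_mul c
      rwa [ht] at h
    obtain ⟨r, hr⟩ := (hiter'.eventually_lt_const hx).exists
    obtain ⟨a, ha, hocc⟩ := (asympGe_meanFieldIter hl hc r 2).asympLe (k := 0) hl hc
    filter_upwards [hl, hocc, hpos, ha.eventually_lt_const hr] with n h0 h1 h2 h3
    refine lt_of_le_of_lt ?_ h3
    rw [← le_div_iff₀' h2.1, div_le_iff₀' h2.2]
    exact h1.2.triFreeMean_le h0

end Asymptotics

section RandomGraph

variable {n : ℕ} {p lam : ℝ}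

/-- A graph on `Fin n` as its set of edges. -/
def graphEquiv (n : ℕ) : SimpleGraph (Fin n) ≃ Finset (Pair n) where
  toFun G := Finset.univ.filter fun e => e.1 ∈ G.edgeSet
  invFun A := SimpleGraph.fromEdgeSet (Subtype.val '' (A : Set (Pair n)))
  left_inv G := by
    ext u v
    simp only [SimpleGraph.fromEdgeSet_adj, Set.mem_image, Finset.mem_coe, Finset.mem_filter,
      Finset.mem_univ, true_and, Subtype.exists, exists_and_right, exists_eq_right]
    constructor
    · rintro ⟨⟨_, h⟩, _⟩
      exact h
    · exact fun h => ⟨⟨by simpa using h.ne, h⟩, h.ne⟩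
  right_inv A := by
    ext e
    simp [SimpleGraph.edgeSet_fromEdgeSet, e.2]

lemma mem_graphEquiv {G : SimpleGraph (Fin n)} {e : Pair n} :
    e ∈ graphEquiv n G ↔ e.1 ∈ G.edgeSet := by
  simp [graphEquiv]

lemma edgeCount_eq_card (G : SimpleGraph (Fin n)) : edgeCount G = (graphEquiv n G).card := by
  rw [edgeCount, ← Nat.card_eq_finsetCard]
  exact Nat.card_congr
    { toFun := fun e => ⟨⟨e.1, G.not_isDiag_of_mem_edgeSet e.2⟩, mem_graphEquiv.2 e.2⟩
      invFun := fun e => ⟨e.1.1, mem_graphEquiv.1 e.2⟩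
      left_inv := fun _ => rfl
      right_inv := fun _ => rfl }

lemma isNClique_three_iff {G : SimpleGraph (Fin n)} {s : Finset (Fin n)} :
    G.IsNClique 3 s ↔ s.card = 3 ∧ pairsIn s ⊆ graphEquiv n G := by
  rw [SimpleGraph.isNClique_iff, and_comm]
  refine and_congr_right fun _ => ⟨fun h e he => ?_, fun h u hu v hv huv => ?_⟩
  · rw [mem_pairsIn] at he
    rw [mem_graphEquiv]
    obtain ⟨e, hd⟩ := e
    induction e with
    | _ u v => exact h (he u (by simp)) (he v (by simp)) (by simpa using hd)
  · have hmem : (⟨s(u, v), by simpa using huv⟩ : Pair n) ∈ pairsIn s := mem_pairsIn.2 fun w hw => by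
      rcases Sym2.mem_iff.1 hw with rfl | rfl <;> assumption
    simpa [mem_graphEquiv] using h hmem

lemma triCount_eq_zero_iff {G : SimpleGraph (Fin n)} :
    triCount G = 0 ↔ ∀ t ∈ triangles n, ¬ t ⊆ graphEquiv n G := by
  rw [triCount, Nat.card_eq_zero, or_iff_left (not_infinite_iff_finite.2 inferInstance),
    isEmpty_subtype]
  simp only [isNClique_three_iff, mem_triangles]
  constructor
  · rintro h t ⟨s, hs, rfl⟩ hsub
    exact h s ⟨hs, hsub⟩
  · exact fun h s hs => h _ ⟨s, hs.1, rfl⟩ hs.2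

lemma erProb_triCount_eq_zero (hp : p < 1) :
    erProb n p {G | triCount G = 0} =
      (1 - p) ^ n.choose 2 * triFreeZ n (p / (1 - p)) := by
  rw [erProb, triFreeZ, gasZ, Finset.sum_filter, Finset.mul_sum]
  refine Fintype.sum_equiv (graphEquiv n) _ _ fun G => ?_
  simp only [Set.mem_ofPred_eq, triCount_eq_zero_iff, Finset.empty_subset, true_and, mul_ite,
    mul_zero, edgeCount_eq_card]
  refine if_congr Iff.rfl ?_ rfl
  have h : (graphEquiv n G).card ≤ n.choose 2 := (Finset.card_le_univ _).trans_eq card_pair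
  have h1 : (1 - p) ≠ 0 := by linarith
  rw [div_pow, ← Nat.sub_add_cancel h, pow_add]
  simp only [Nat.add_sub_cancel]
  field_simp

lemma triFreeZ_le_one_add_pow (hl : 0 ≤ lam) : triFreeZ n lam ≤ (1 + lam) ^ n.choose 2 := by
  have h := Fintype.sum_pow_mul_eq_add_pow (Pair n) lam 1
  simp only [one_pow, mul_one, card_pair] at h
  rw [add_comm 1, ← h, triFreeZ, gasZ]
  exact Finset.sum_le_sum_of_subset_of_nonneg (Finset.subset_univ _)
    fun _ _ _ => pow_nonneg hl _

lemma erProb_triCount_eq_zero_le_one (h0 : 0 ≤ p) (hp : p < 1) :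
    erProb n p {G | triCount G = 0} ≤ 1 := by
  have h1 : 0 < 1 - p := by linarith
  rw [erProb_triCount_eq_zero hp]
  calc (1 - p) ^ n.choose 2 * triFreeZ n (p / (1 - p))
      ≤ (1 - p) ^ n.choose 2 * (1 + p / (1 - p)) ^ n.choose 2 := by
        gcongr
        exact triFreeZ_le_one_add_pow (by positivity)
    _ = 1 := by
        rw [← mul_pow, mul_add, mul_div_cancel₀ _ h1.ne']
        simp

/-- The pairs joining the first `n / 2` vertices to the others. -/
def crossPairs (n : ℕ) : Finset (Pair n) :=
  ((Finset.univ.filter fun v : Fin n => (v : ℕ) < n / 2) ×ˢ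
    (Finset.univ.filter fun v : Fin n => ¬ (v : ℕ) < n / 2)).attach.image
      fun x => ⟨s(x.1.1, x.1.2), by
        have h := x.2
        simp only [Finset.mem_product, Finset.mem_filter] at h
        intro hd
        rw [Sym2.mk_isDiag_iff] at hd
        exact h.2.2 (hd ▸ h.1.2)⟩

lemma card_crossPairs (n : ℕ) : (crossPairs n).card = (n / 2) * (n - n / 2) := by
  rw [crossPairs, Finset.card_image_of_injective]
  · rw [Finset.card_attach, Finset.card_product]
    have h1 : (Finset.univ.filter fun v : Fin n => (v : ℕ) < n / 2).card = n / 2 := by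
      rw [Fin.card_filter_val_lt]
      omega
    have h2 := Finset.card_filter_add_card_filter_not (s := (Finset.univ : Finset (Fin n)))
      (fun v : Fin n => (v : ℕ) < n / 2)
    rw [Finset.card_univ, Fintype.card_fin, h1] at h2
    rw [h1]
    congr 1
    omega
  · rintro ⟨⟨a, b⟩, hx⟩ ⟨⟨c, d⟩, hy⟩ h
    simp only [Finset.mem_product, Finset.mem_filter, Finset.mem_univ, true_and] at hx hy
    simp only [Subtype.mk.injEq, Sym2.eq_iff] at h
    rcases h with ⟨rfl, rfl⟩ | ⟨rfl, rfl⟩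
    · rfl
    · exact absurd hx.1 hy.2

lemma lt_half_iff_of_mem_crossPairs {u v : Fin n} (h : ¬ (s(u, v)).IsDiag)
    (hm : (⟨s(u, v), h⟩ : Pair n) ∈ crossPairs n) : (u : ℕ) < n / 2 ↔ ¬ (v : ℕ) < n / 2 := by
  simp only [crossPairs, Finset.mem_image, Finset.mem_attach, true_and, Subtype.exists,
    Prod.exists, Subtype.mk.injEq, Finset.mem_product, Finset.mem_filter, Finset.mem_univ] at hm
  obtain ⟨a, b, ⟨ha, hb⟩, hab⟩ := hm
  rcases Sym2.eq_iff.1 hab with ⟨rfl, rfl⟩ | ⟨rfl, rfl⟩ <;> tauto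

lemma not_subset_crossPairs {t : Finset (Pair n)} (ht : t ∈ triangles n) :
    ¬ t ⊆ crossPairs n := by
  obtain ⟨s, hs, rfl⟩ := mem_triangles.1 ht
  obtain ⟨a, b, c, hab, hac, hbc, rfl⟩ := Finset.card_eq_three.1 hs
  intro h
  have key : ∀ u ∈ ({a, b, c} : Finset (Fin n)), ∀ v ∈ ({a, b, c} : Finset (Fin n)), u ≠ v →
      ((u : ℕ) < n / 2 ↔ ¬ (v : ℕ) < n / 2) := fun u hu v hv huv =>
    lt_half_iff_of_mem_crossPairs (by simpa using huv) (h (mem_pairsIn.2 fun w hw => by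
      rcases Sym2.mem_iff.1 hw with rfl | rfl <;> assumption))
  have h1 := key a (by simp) b (by simp) hab
  have h2 := key a (by simp) c (by simp) hac
  have h3 := key b (by simp) c (by simp) hbc
  tauto

lemma one_add_pow_le_triFreeZ (hl : 0 ≤ lam) :
    (1 + lam) ^ ((n / 2) * (n - n / 2)) ≤ triFreeZ n lam := by
  have h := Finset.sum_pow_mul_eq_add_pow lam 1 (crossPairs n)
  simp only [one_pow, mul_one, card_crossPairs] at h
  rw [add_comm 1, ← h, triFreeZ, gasZ]
  refine Finset.sum_le_sum_of_subset_of_nonneg (fun G hG => ?_) fun _ _ _ => pow_nonneg hl _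
  simp only [Finset.mem_filter, Finset.mem_univ, Finset.empty_subset, true_and]
  exact fun t ht hsub => not_subset_crossPairs ht (hsub.trans (Finset.mem_powerset.1 hG))

lemma pow_le_erProb_triCount_eq_zero (h0 : 0 ≤ p) (hp : p < 1) :
    (1 - p) ^ (n.choose 2 - (n / 2) * (n - n / 2)) ≤ erProb n p {G | triCount G = 0} := by
  have h1 : 0 < 1 - p := by linarith
  have hle : (n / 2) * (n - n / 2) ≤ n.choose 2 := by
    rw [← card_crossPairs, ← card_pair]
    exact Finset.card_le_univ _
  rw [erProb_triCount_eq_zero hp]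
  calc (1 - p) ^ (n.choose 2 - (n / 2) * (n - n / 2))
      = (1 - p) ^ n.choose 2 * (1 + p / (1 - p)) ^ ((n / 2) * (n - n / 2)) := by
        have : 1 + p / (1 - p) = (1 - p)⁻¹ := by field_simp; ring
        rw [this, inv_pow, pow_sub₀ _ h1.ne' hle]
    _ ≤ _ := by
        gcongr
        exact one_add_pow_le_triFreeZ (by positivity)

lemma choose_two_sub_half_mul_le (n : ℕ) :
    ((n.choose 2 - (n / 2) * (n - n / 2) : ℕ) : ℝ) ≤ (n : ℝ) ^ 2 / 4 := by
  have h : n.choose 2 - (n / 2) * (n - n / 2) ≤ (n / 2) * (n / 2) := by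
    rw [Nat.choose_two_right, tsub_le_iff_right, ← mul_add]
    rcases Nat.even_or_odd' n with ⟨m, rfl | rfl⟩
    · have h1 : 2 * m / 2 = m := by omega
      rw [h1, mul_assoc, Nat.mul_div_cancel_left _ two_pos]
      exact Nat.mul_le_mul_left _ (by omega)
    · have h1 : (2 * m + 1) / 2 = m := by omega
      rw [h1, Nat.add_sub_cancel, mul_left_comm, Nat.mul_div_cancel_left _ two_pos, mul_comm]
      exact Nat.mul_le_mul_left _ (by omega)
  have h2 : ((n / 2 : ℕ) : ℝ) ≤ n / 2 := Nat.cast_div_le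
  calc ((n.choose 2 - (n / 2) * (n - n / 2) : ℕ) : ℝ) ≤ ((n / 2 : ℕ) : ℝ) * ((n / 2 : ℕ) : ℝ) := by
        exact_mod_cast h
    _ ≤ (n / 2) * (n / 2) := by gcongr
    _ = (n : ℝ) ^ 2 / 4 := by ring

end RandomGraph

section FreeEnergy

open Set Topology

variable {n : ℕ} {lam : ℝ}

lemma tendsto_of_tendsto_deriv {f f' : ℕ → ℝ → ℝ} {g : ℝ → ℝ} {x C : ℝ} (hx : 0 ≤ x)
    (hcont : ∀ᶠ n in atTop, ContinuousOn (f n) (Icc 0 x))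
    (hderiv : ∀ᶠ n in atTop, ∀ u ∈ Ioc 0 x, HasDerivAt (f n) (f' n u) u)
    (hbound : ∀ᶠ n in atTop, ∀ u ∈ Ioc 0 x, 0 ≤ f' n u ∧ f' n u ≤ C)
    (hlim : ∀ u ∈ Ioc 0 x, Tendsto (f' · u) atTop (𝓝 (g u))) :
    Tendsto (fun n => f n x - f n 0) atTop (𝓝 (∫ u in 0..x, g u)) := by
  have hint : ∀ᶠ n in atTop, IntervalIntegrable (f' n) MeasureTheory.volume 0 x := by
    filter_upwards [hcont, hderiv, hbound] with n h1 h2 h3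
    refine intervalIntegral.intervalIntegrable_deriv_of_nonneg (g := f n)
      (by rwa [uIcc_of_le hx]) ?_ ?_ <;> rw [min_eq_left hx, max_eq_right hx]
    · exact fun u hu => h2 u (Ioo_subset_Ioc_self hu)
    · exact fun u hu => (h3 u (Ioo_subset_Ioc_self hu)).1
  have heq : (fun n => ∫ u in 0..x, f' n u) =ᶠ[atTop] fun n => f n x - f n 0 := by
    filter_upwards [hcont, hderiv, hint] with n h1 h2 h3
    exact intervalIntegral.integral_eq_sub_of_hasDerivAt_of_le hx h1
      (fun u hu => h2 u (Ioo_subset_Ioc_self hu)) h3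
  refine Tendsto.congr' heq ?_
  refine intervalIntegral.tendsto_integral_filter_of_dominated_convergence (fun _ => C) ?_ ?_
    intervalIntegrable_const (Eventually.of_forall fun u hu => hlim u (by rwa [uIoc_of_le hx] at hu))
  · filter_upwards [hint] with n h
    exact h.def'.aestronglyMeasurable
  · filter_upwards [hbound] with n h
    refine Eventually.of_forall fun u hu => ?_
    rw [uIoc_of_le hx] at hu
    rw [Real.norm_of_nonneg (h u hu).1]
    exact (h u hu).2

lemma hasDerivAt_log_triFreeZ (n : ℕ) (hl : 0 < lam) :
    HasDerivAt (fun l => Real.log (triFreeZ n l)) (triFreeMean n lam / lam) lam := by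
  have h : HasDerivAt (triFreeZ n) ((∑ f : Pair n, gasZ lam {f} (triangles n)) / lam) lam := by
    have h1 : ∑ f : Pair n, gasZ lam {f} (triangles n) =
        ∑ G : Finset (Pair n) with ∅ ⊆ G ∧ ∀ t ∈ triangles n, ¬ t ⊆ G,
          (G.card : ℝ) * lam ^ G.card := by
      simp only [gasZ, Finset.sum_filter]
      rw [Finset.sum_comm]
      refine Finset.sum_congr rfl fun G _ => ?_
      by_cases hG : ∀ t ∈ triangles n, ¬ t ⊆ G
      · simp only [eq_true hG, and_true, Finset.singleton_subset_iff, Finset.empty_subset, if_true]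
        rw [← Finset.sum_filter, Finset.filter_univ_mem, Finset.sum_const, nsmul_eq_mul]
      · simp only [eq_false hG, and_false, if_false, Finset.sum_const_zero]
    rw [h1, Finset.sum_div]
    change HasDerivAt (fun l => ∑ G : Finset (Pair n) with ∅ ⊆ G ∧ ∀ t ∈ triangles n, ¬ t ⊆ G,
      l ^ G.card) _ _
    refine HasDerivAt.fun_sum fun G _ => ?_
    refine (hasDerivAt_pow G.card lam).congr_deriv ?_
    rcases Nat.eq_zero_or_pos G.card with h0 | h0
    · simp [h0]
    · rw [mul_div_assoc, ← Nat.sub_add_cancel h0, pow_succ]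
      simp only [Nat.add_sub_cancel]
      rw [mul_div_cancel_right₀ _ hl.ne']
  refine (h.log (triFreeZ_pos n hl.le).ne').congr_deriv ?_
  rw [triFreeMean, div_right_comm]

/-- The inverse of the map sending the edge intensity to the mean-field edge density. -/
def intensity (u : ℝ) : ℝ := u * Real.exp (u ^ 2)

lemma hasDerivAt_intensity (u : ℝ) :
    HasDerivAt intensity (Real.exp (u ^ 2) * (1 + 2 * u ^ 2)) u := by
  refine ((hasDerivAt_id u).mul ((hasDerivAt_pow 2 u).exp)).congr_deriv ?_
  simp only [id_eq, Nat.cast_ofNat]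
  ring

lemma intensity_mul_exp (u : ℝ) : intensity u * Real.exp (-u ^ 2) = u := by
  rw [intensity, mul_assoc, ← Real.exp_add]
  simp

lemma intensity_le {u v : ℝ} (hu : 0 ≤ u) (huv : u ≤ v) : intensity u ≤ intensity v := by
  unfold intensity
  gcongr
  exact hu.trans huv

lemma intensity_pos {u : ℝ} (hu : 0 < u) : 0 < intensity u := by
  unfold intensity
  positivity

lemma natCast_rpow_three_halves (n : ℕ) : (n : ℝ) ^ ((3 : ℝ) / 2) = n * √n := by
  rcases Nat.eq_zero_or_pos n with rfl | hn
  · norm_num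
  · rw [Real.sqrt_eq_rpow, ← Real.rpow_one_add' (by positivity) (by norm_num)]
    norm_num

lemma tendsto_choose_two_div_sq :
    Tendsto (fun n : ℕ => (n.choose 2 : ℝ) / n ^ 2) atTop (𝓝 (1 / 2)) := by
  have h : Tendsto (fun n : ℕ => (1 - (n : ℝ)⁻¹) / 2) atTop (𝓝 ((1 - 0) / 2)) :=
    (tendsto_const_nhds.sub tendsto_inv_atTop_nhds_zero_nat).div_const 2
  rw [sub_zero] at h
  refine h.congr' ?_
  filter_upwards [eventually_gt_atTop 0] with n hn
  have : (0 : ℝ) < n := by exact_mod_cast hn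
  rw [Nat.cast_choose_two]
  field_simp

lemma choose_two_le_sq_div_two (n : ℕ) : (n.choose 2 : ℝ) ≤ n ^ 2 / 2 := by
  rw [Nat.cast_choose_two]
  nlinarith [n.cast_nonneg (α := ℝ)]

/-- The fugacity corresponding to the edge probability `c / √n`. -/
def fugacity (n : ℕ) (c : ℝ) : ℝ := c / (√n - c)

lemma fugacity_eq {c : ℝ} (hn : 0 < n) : (c / √n) / (1 - c / √n) = fugacity n c := by
  have : 0 < √(n : ℝ) := Real.sqrt_pos.2 (by exact_mod_cast hn)
  rw [fugacity, one_sub_div this.ne', div_div_div_cancel_right₀ this.ne']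

lemma fugacity_nonneg {c : ℝ} (hc : 0 ≤ c) (hcn : c ≤ √n) : 0 ≤ fugacity n c :=
  div_nonneg hc (sub_nonneg.2 hcn)

lemma hasDerivAt_fugacity {c : ℝ} (hcn : c < √n) :
    HasDerivAt (fugacity n) (√n / (√n - c) ^ 2) c := by
  have h : √(n : ℝ) - c ≠ 0 := (sub_pos.2 hcn).ne'
  refine ((hasDerivAt_id c).div ((hasDerivAt_id c).const_sub √(n : ℝ)) h).congr_deriv ?_
  simp

lemma tendsto_sqrt_div_sqrt_sub (c : ℝ) :
    Tendsto (fun n : ℕ => √n / (√n - c)) atTop (𝓝 1) := by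
  have h : Tendsto (fun n : ℕ => (1 - c / √n)⁻¹) atTop (𝓝 (1 - 0)⁻¹) :=
    ((tendsto_div_sqrt tendsto_const_nhds).const_sub 1).inv₀ (by norm_num)
  rw [sub_zero, inv_one] at h
  refine h.congr' ?_
  filter_upwards [tendsto_sqrt_natCast.eventually_gt_atTop 0] with n hn
  rw [one_sub_div hn.ne', inv_div]

lemma hasDerivAt_log_triFreeZ_fugacity {u : ℝ} (hu : 0 < u) (hun : intensity u < √n) :
    HasDerivAt (fun v => Real.log (triFreeZ n (fugacity n (intensity v))))
      (triFreeMean n (fugacity n (intensity u)) * (√n / (√n - intensity u)) *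
        ((1 + 2 * u ^ 2) / u)) u := by
  have hc := intensity_pos hu
  have hd := sub_pos.2 hun
  have hl : 0 < fugacity n (intensity u) := div_pos hc hd
  refine ((hasDerivAt_log_triFreeZ n hl).comp u
    ((hasDerivAt_fugacity hun).comp u (hasDerivAt_intensity u))).congr_deriv ?_
  have h : Real.exp (u ^ 2) / intensity u = 1 / u := by
    rw [intensity]
    field_simp
  calc _ = triFreeMean n (fugacity n (intensity u)) * (√n / (√n - intensity u)) *
        (Real.exp (u ^ 2) / intensity u * (1 + 2 * u ^ 2)) := by
        rw [fugacity]
        field_simp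
    _ = _ := by rw [h]; ring

lemma tendsto_log_triFreeZ_fugacity {x : ℝ} (hx : 0 ≤ x) (hx1 : intensity x < 1) :
    Tendsto (fun n : ℕ => Real.log (triFreeZ n (fugacity n (intensity x))) / (n * √n)) atTop
      (𝓝 (x / 2 + x ^ 3 / 3)) := by
  have hlarge : ∀ᶠ n : ℕ in atTop, 2 ≤ √(n : ℝ) := tendsto_sqrt_natCast.eventually_ge_atTop 2
  have hlt : ∀ u ∈ Icc 0 x, intensity u < 1 := fun u hu => (intensity_le hu.1 hu.2).trans_lt hx1
  have hnn : ∀ u ∈ Icc 0 x, 0 ≤ intensity u := fun u hu => mul_nonneg hu.1 (Real.exp_pos _).le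
  have h := tendsto_of_tendsto_deriv (x := x)
    (f := fun n u => Real.log (triFreeZ n (fugacity n (intensity u))) / (n * √n))
    (f' := fun n u => (triFreeMean n (fugacity n (intensity u)) * (√n / (√n - intensity u)) *
        ((1 + 2 * u ^ 2) / u)) / (n * √n))
    (g := fun u => 1 / 2 + u ^ 2) (C := 2 * (Real.exp (x ^ 2) * (1 + 2 * x ^ 2))) hx ?_ ?_ ?_ ?_
  · have hI : ∫ u in 0..x, (1 / 2 + u ^ 2) = x / 2 + x ^ 3 / 3 := by
      rw [intervalIntegral.integral_add (by simp) (by simp)]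
      simp only [intervalIntegral.integral_const, integral_pow, smul_eq_mul]
      norm_num
      ring
    rw [hI] at h
    refine h.congr fun n => ?_
    have h0 : Real.log (triFreeZ n (fugacity n (intensity 0))) = 0 := by
      have h1 : fugacity n (intensity 0) = 0 := by simp [fugacity, intensity]
      have h2 := triFreeZ_le_one_add_pow (n := n) (le_refl (0 : ℝ))
      have h3 := one_add_pow_le_triFreeZ (n := n) (le_refl (0 : ℝ))
      rw [add_zero, one_pow] at h2 h3
      rw [h1, le_antisymm h2 h3, Real.log_one]
    simp [h0]
  · filter_upwards [hlarge] with n hn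
    refine ContinuousOn.div_const (ContinuousOn.log ?_ fun u hu => ?_) _
    · refine Continuous.comp_continuousOn (g := triFreeZ n) ?_ ?_
      · unfold triFreeZ gasZ
        fun_prop
      · refine ContinuousOn.div ?_ ?_ fun u hu => ?_
        · unfold intensity
          fun_prop
        · unfold intensity
          fun_prop
        · linarith [hlt u hu]
    · exact (triFreeZ_pos n (fugacity_nonneg (hnn u hu) (by linarith [hlt u hu]))).ne'
  · filter_upwards [hlarge] with n hn u hu
    exact (hasDerivAt_log_triFreeZ_fugacity hu.1
      (by linarith [hlt u (Ioc_subset_Icc_self hu)])).div_const _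
  · filter_upwards [hlarge] with n hn u hu
    have hu' := Ioc_subset_Icc_self hu
    have hu0 : 0 < u := hu.1
    have h1 := hlt u hu'
    have hpos := intensity_pos hu0
    have hl := fugacity_nonneg (n := n) (hnn u hu') (by linarith)
    have hd : √(n : ℝ) / 2 ≤ √n - intensity u := by linarith
    have hd0 : 0 < √(n : ℝ) - intensity u := by linarith
    have hn0 : (0 : ℝ) < √n := by linarith
    have hnn' : (0 : ℝ) < n := Real.sqrt_pos.1 hn0
    have hsq : √(n : ℝ) * √n = n := Real.mul_self_sqrt hnn'.le
    refine ⟨div_nonneg (mul_nonneg (mul_nonneg (triFreeMean_nonneg n hl) (by positivity))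
      (by positivity)) (by positivity), ?_⟩
    have h2 : √(n : ℝ) / (√n - intensity u) ≤ 2 := by
      rw [div_le_iff₀ hd0]
      linarith
    have h3 : triFreeMean n (fugacity n (intensity u)) ≤ n * √n * intensity u := by
      refine (triFreeMean_le n hl).trans ?_
      have h4 : fugacity n (intensity u) ≤ intensity u / (√n / 2) :=
        div_le_div_of_nonneg_left hpos.le (by positivity) hd
      calc (n.choose 2 : ℝ) * fugacity n (intensity u)
          ≤ (n ^ 2 / 2) * (intensity u / (√n / 2)) := by
            gcongr
            exact choose_two_le_sq_div_two n
        _ = n * √n * intensity u := by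
            rw [sq]
            nth_rewrite 2 [← hsq]
            field_simp
    rw [div_le_iff₀ (by positivity)]
    calc _ ≤ (n * √n * intensity u) * 2 * ((1 + 2 * u ^ 2) / u) := by gcongr
      _ = 2 * (Real.exp (u ^ 2) * (1 + 2 * u ^ 2)) * (n * √n) := by
          rw [intensity]
          field_simp
      _ ≤ _ := by
          have := hu.2
          gcongr
  · intro u hu
    have hu0 : 0 < u := hu.1
    have hu' := Ioc_subset_Icc_self hu
    have hmean : Tendsto (fun n : ℕ =>
        √n * (triFreeMean n (fugacity n (intensity u)) / n.choose 2)) atTop (𝓝 u) := by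
      refine tendsto_triFreeMean (c := intensity u) ?_ ?_ (hnn u hu') (hlt u hu')
        (intensity_mul_exp u)
      · filter_upwards [hlarge] with n hn
        exact fugacity_nonneg (hnn u hu') (by linarith [hlt u hu'])
      · have h := (tendsto_sqrt_div_sqrt_sub (intensity u)).mul_const (intensity u)
        rw [one_mul] at h
        refine h.congr fun n => ?_
        rw [fugacity, mul_div_assoc', div_mul_eq_mul_div]
    have h := ((hmean.mul tendsto_choose_two_div_sq).mul
      (tendsto_sqrt_div_sqrt_sub (intensity u))).mul_const ((1 + 2 * u ^ 2) / u)
    have he : u * (1 / 2) * 1 * ((1 + 2 * u ^ 2) / u) = 1 / 2 + u ^ 2 := by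
      field_simp
    rw [he] at h
    refine h.congr' ?_
    filter_upwards [eventually_ge_atTop 2] with n hn
    have hn' : (0 : ℝ) < n := by exact_mod_cast (by omega : 0 < n)
    have hs : 0 < √(n : ℝ) := Real.sqrt_pos.2 hn'
    have hch : (0 : ℝ) < n.choose 2 := by exact_mod_cast Nat.choose_pos hn
    have hsq : √(n : ℝ) / n ^ 2 = 1 / (n * √n) := by
      rw [div_eq_div_iff (by positivity) (by positivity)]
      nlinarith [Real.mul_self_sqrt hn'.le]
    calc _ = triFreeMean n (fugacity n (intensity u)) * (√n / (√n - intensity u)) *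
        ((1 + 2 * u ^ 2) / u) * (√n / n ^ 2) := by field_simp
      _ = _ := by rw [hsq, mul_one_div]

end FreeEnergy

section RateFunction

open Set Topology

/-- The exponential rate of triangle-freeness at edge probability `c / √n`. -/
def triFreeRate (c : ℝ) : ℝ :=
  liminf (fun n : ℕ => Real.log (erProb n (min 1 (c / √n)) {G | triCount G = 0}) /
    (n : ℝ) ^ ((3 : ℝ) / 2)) atTop

lemma eventually_min_one_div_sqrt (c : ℝ) :
    ∀ᶠ n : ℕ in atTop, min 1 (c / √n) = c / √n ∧ c / √n < 1 := by
  filter_upwards [(tendsto_div_sqrt (tendsto_const_nhds (x := c))).eventually_lt_const zero_lt_one]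
    with n hn
  exact ⟨min_eq_right hn.le, hn⟩

lemma tendsto_sqrt_mul_log_one_sub (c : ℝ) :
    Tendsto (fun n : ℕ => √n * Real.log (1 - c / √n)) atTop (𝓝 (-c)) := by
  refine ((Real.tendsto_mul_log_one_add_div_atTop (-c)).comp tendsto_sqrt_natCast).congr fun n => ?_
  rw [Function.comp_apply, neg_div, ← sub_eq_add_neg]

lemma neg_div_four_le_triFreeRate {c : ℝ} (hc : 0 ≤ c) : -c / 4 ≤ triFreeRate c := by
  have hlim : Tendsto (fun n : ℕ => √n * Real.log (1 - c / √n) / 4) atTop (𝓝 (-c / 4)) :=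
    (tendsto_sqrt_mul_log_one_sub c).div_const 4
  rw [← hlim.liminf_eq]
  refine liminf_le_liminf ?_ hlim.isBoundedUnder_ge ?_
  · filter_upwards [eventually_min_one_div_sqrt c, eventually_gt_atTop 0] with n hn hn0
    have hn' : (0 : ℝ) < n := by exact_mod_cast hn0
    have hs : 0 < √(n : ℝ) := Real.sqrt_pos.2 hn'
    have h1 : 0 < 1 - c / √n := sub_pos.2 hn.2
    rw [hn.1, natCast_rpow_three_halves, le_div_iff₀ (by positivity)]
    have hlog : Real.log (1 - c / √n) ≤ 0 := Real.log_nonpos h1.le (by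
      have : 0 ≤ c / √n := by positivity
      linarith)
    calc √n * Real.log (1 - c / √n) / 4 * (n * √n)
        = (n : ℝ) ^ 2 / 4 * Real.log (1 - c / √n) := by
          linear_combination (n / 4 * Real.log (1 - c / √n)) * Real.mul_self_sqrt hn'.le
      _ ≤ ((n.choose 2 - (n / 2) * (n - n / 2) : ℕ) : ℝ) * Real.log (1 - c / √n) :=
          mul_le_mul_of_nonpos_right (choose_two_sub_half_mul_le n) hlog
      _ ≤ _ := by
          rw [← Real.log_pow]
          exact Real.log_le_log (by positivity)
            (pow_le_erProb_triCount_eq_zero (by positivity) hn.2)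
  · refine IsBoundedUnder.isCoboundedUnder_ge ⟨0, ?_⟩
    rw [eventually_map]
    filter_upwards [eventually_min_one_div_sqrt c] with n hn
    have h1 : 0 < 1 - c / √n := sub_pos.2 hn.2
    rw [hn.1]
    refine div_nonpos_of_nonpos_of_nonneg (Real.log_nonpos ?_ ?_) (by positivity)
    · exact (by positivity : (0 : ℝ) ≤ _).trans
        (pow_le_erProb_triCount_eq_zero (by positivity) hn.2)
    · exact erProb_triCount_eq_zero_le_one (by positivity) hn.2

/-- The rate of triangle-freeness below the transition, in terms of the mean-field density. -/
def lowDensityRate (x : ℝ) : ℝ := -intensity x / 2 + x / 2 + x ^ 3 / 3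

lemma triFreeRate_intensity {x : ℝ} (hx : 0 ≤ x) (hx1 : intensity x < 1) :
    triFreeRate (intensity x) = lowDensityRate x := by
  have hc : 0 ≤ intensity x := mul_nonneg hx (Real.exp_pos _).le
  have h := (tendsto_choose_two_div_sq.mul (tendsto_sqrt_mul_log_one_sub (intensity x))).add
    (tendsto_log_triFreeZ_fugacity hx hx1)
  have he : 1 / 2 * -intensity x + (x / 2 + x ^ 3 / 3) = lowDensityRate x := by
    rw [lowDensityRate]
    ring
  rw [he] at h
  refine Tendsto.liminf_eq (h.congr' ?_)
  filter_upwards [eventually_min_one_div_sqrt (intensity x), eventually_gt_atTop 0] with n hn hn0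
  have hn' : (0 : ℝ) < n := by exact_mod_cast hn0
  have hs : 0 < √(n : ℝ) := Real.sqrt_pos.2 hn'
  have h1 : 0 < 1 - intensity x / √n := sub_pos.2 hn.2
  have hf : 0 ≤ fugacity n (intensity x) := by
    rw [← fugacity_eq hn0]
    positivity
  rw [hn.1, natCast_rpow_three_halves, erProb_triCount_eq_zero hn.2, fugacity_eq hn0,
    Real.log_mul (pow_pos h1 _).ne' (triFreeZ_pos n hf).ne', Real.log_pow, add_div]
  congr 1
  have hsq : √(n : ℝ) / n ^ 2 = 1 / (n * √n) := by
    rw [div_eq_div_iff (by positivity) (by positivity)]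
    nlinarith [Real.mul_self_sqrt hn'.le]
  rw [div_mul_eq_mul_div, ← mul_assoc, mul_right_comm, mul_div_assoc, hsq, mul_one_div]

lemma analyticAt_intensity (x : ℝ) : AnalyticAt ℝ intensity x := by
  unfold intensity
  fun_prop

lemma analyticAt_lowDensityRate (x : ℝ) : AnalyticAt ℝ lowDensityRate x := by
  have := analyticAt_intensity x
  unfold lowDensityRate
  fun_prop (disch := norm_num)

lemma exp_sq_bounds :
    2 + 4 / 3 * (1.1519 : ℝ) ^ 2 < Real.exp (1.1519 ^ 2) ∧
      1.1519 * Real.exp (1.1519 ^ 2) < (4.342 : ℝ) := by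
  have he : Real.exp ((1.1519 : ℝ) ^ 2) = Real.exp 1 * Real.exp 0.32687361 := by
    rw [← Real.exp_add]
    norm_num
  have h1 := Real.exp_one_gt_d9
  have h2 := Real.exp_one_lt_d9
  have h3 := Real.sum_le_exp_of_nonneg (x := 0.32687361) (by norm_num) 8
  have h4 := Real.exp_bound' (x := 0.32687361) (by norm_num) (by norm_num) (n := 8) (by norm_num)
  norm_num [Finset.sum_range_succ, Nat.factorial] at h3 h4
  rw [he]
  constructor <;> norm_num at * <;> nlinarith

lemma lowDensityRate_lt :
    lowDensityRate 1.1519 < -intensity 1.1519 / 4 := by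
  have h := exp_sq_bounds.1
  unfold lowDensityRate intensity
  nlinarith

lemma exp_neg_half_le_intensity : Real.exp (-(1 : ℝ) / 2) ≤ intensity 0.55 := by
  have h1 : Real.exp (-(1 : ℝ) / 2) ≤ 1 / 1.5 := by
    rw [neg_div, Real.exp_neg, ← one_div]
    exact one_div_le_one_div_of_le (by norm_num) (by linarith [Real.add_one_le_exp (1 / 2 : ℝ)])
  have h2 := Real.add_one_le_exp ((0.55 : ℝ) ^ 2)
  unfold intensity
  norm_num at *
  linarith

lemma intensity_lt_one : intensity 0.6 < 1 := by
  have h := Real.exp_bound' (x := (0.6 : ℝ) ^ 2) (by norm_num) (by norm_num) (n := 3) (by norm_num)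
  norm_num [Finset.sum_range_succ, Nat.factorial] at h
  unfold intensity
  norm_num
  linarith

lemma exists_not_analyticAt_triFreeRate :
    ∃ c : ℝ, Real.exp (-(1 : ℝ) / 2) ≤ c ∧ c < 4.342 ∧ ¬ AnalyticAt ℝ triFreeRate c := by
  by_contra! hA
  have hleft : AnalyticOnNhd ℝ (triFreeRate ∘ intensity) (Icc 0.55 1.1519) := by
    intro x hx
    refine AnalyticAt.comp (hA _ ?_ ?_) (analyticAt_intensity x)
    · exact exp_neg_half_le_intensity.trans (intensity_le (by norm_num) hx.1)
    · exact (intensity_le (by linarith [hx.1]) hx.2).trans_lt exp_sq_bounds.2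
  have hright : AnalyticOnNhd ℝ lowDensityRate (Icc 0.55 1.1519) :=
    fun x _ => analyticAt_lowDensityRate x
  have hnear : triFreeRate ∘ intensity =ᶠ[𝓝 0.55] lowDensityRate := by
    filter_upwards [Ioo_mem_nhds (show (0 : ℝ) < 0.55 by norm_num)
      (show (0.55 : ℝ) < 0.6 by norm_num)] with x hx
    exact triFreeRate_intensity hx.1.le ((intensity_le hx.1.le hx.2.le).trans_lt intensity_lt_one)
  have heq := hleft.eqOn_of_preconnected_of_eventuallyEq hright isPreconnected_Icc
    (left_mem_Icc.2 (by norm_num)) hnear (right_mem_Icc.2 (by norm_num))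
  have hlower := neg_div_four_le_triFreeRate (intensity_pos (u := 1.1519) (by norm_num)).le
  rw [Function.comp_apply] at heq
  linarith [lowDensityRate_lt]

end RateFunction

/-- **Corollary (phase transition for triangle-freeness in `G(n,p)`).**
The lower-tail rate function `φ₀` has a non-analytic point in `[e^{-1/2}, 4.342)`. -/
theorem phase_transition_triangle_free :
    ∃ cstar : ℝ, Real.exp (-(1 : ℝ) / 2) ≤ cstar ∧ cstar < (4.342 : ℝ) ∧
      ¬ AnalyticAt ℝ (fun c : ℝ =>
        Filter.liminf (fun n : ℕ =>
          Real.log (erProb n (min 1 (c / Real.sqrt n)) {G | triCount G = 0}) /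
            (n : ℝ) ^ ((3 : ℝ) / 2)) atTop) cstar := by
  exact exists_not_analyticAt_triFreeRate
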